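/- Let n > 2 be an integer such that k₁(n) ≥ 4. Then the full matrix ring 𝕄ₙ(𝔽₂) is almost n-torsion clean. -/

import Mathlib

def AlmostTorsionClean (R : Type*) [Ring R] (m : ℕ) : Prop :=
  ∀ r : R, ∃ u e : R, IsUnit u ∧ u ^ m = 1 ∧ e * e = e ∧ r = u + e

def TorsionClean (R : Type*) [Ring R] (m : ℕ) : Prop :=
  AlmostTorsionClean R m ∧ ∀ k : ℕ, 0 < k → k < m → ¬ AlmostTorsionClean R k

/-- `k1 m` is the smallest `k` with `1 ≤ k ≤ m` such that `C(m, k)` is odd. -/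
noncomputable def k1 (m : ℕ) : ℕ := sInf {k | 1 ≤ k ∧ k ≤ m ∧ Odd (m.choose k)}

open Polynomial

theorem four_dvd (n : ℕ) (hn : 2 < n) (h : 4 ≤ sInf {k | 1 ≤ k ∧ k ≤ n ∧ Odd (n.choose k)}) : 4 ∣ n := by
  have key : ∀ k, 1 ≤ k → k ≤ 3 → Even (n.choose k) := by
    intro k h1 h3
    by_contra hc
    rw [Nat.not_even_iff_odd] at hc
    have := Nat.sInf_le (show k ∈ {k | 1 ≤ k ∧ k ≤ n ∧ Odd (n.choose k)} from ⟨h1, by omega, hc⟩)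
    omega
  have h1 := key 1 le_rfl (by norm_num)
  have h2 := key 2 (by norm_num) (by norm_num)
  rw [Nat.choose_one_right] at h1
  obtain ⟨m, rfl⟩ := h1
  obtain ⟨r, hr⟩ := h2
  rw [Nat.choose_two_right] at hr
  have e : (m+m)*(m+m-1)/2 = m*(m+m-1) := by
    rw [show (m+m)*(m+m-1) = 2*(m*(m+m-1)) by ring]; simp
  rw [e] at hr
  have : Even (m*(m+m-1)) := ⟨r, hr⟩
  rcases Nat.even_mul.1 this with ⟨s, hs⟩ | ⟨s, hs⟩ <;> omega

theorem abs_lemma {M : Type*} [AddCommGroup M] [Module (ZMod 2) M] (d : ℕ) (hd : 1 ≤ d)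
    (f : M →ₗ[ZMod 2] M) (B : ℕ → M) (b : Module.Basis (Fin d) (ZMod 2) M)
    (hb : ∀ i, b i = B i) (a : ℕ → ZMod 2) (hf : ∀ i, f (B i) = B (i+1) + a i • B i)
    (hB : B d ∈ Submodule.span (ZMod 2) (B '' {i | i < d - 1}))
    (ha : ∀ i, 1 ≤ i → i < d → a i = if Odd (d-1-i) then 1 else 0)
    (h2 : d = 2 → a 0 = 1) :
    ∃ E N : M →ₗ[ZMod 2] M, E * E = E ∧ N ^ 4 = 0 ∧ f = E + N := by
  classical
  obtain ⟨s, hs⟩ : ∃ s : ℕ → ZMod 2, s = fun i => if Odd (d-1-i) then a i else 0 := ⟨_, rfl⟩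
  obtain ⟨E, hE⟩ : ∃ E : M →ₗ[ZMod 2] M, E = b.constr (ZMod 2) (fun i => a i • B i + s i • B (i+1)) :=
    ⟨_, rfl⟩
  have hEB : ∀ i, i < d → E (B i) = a i • B i + s i • B (i+1) := by
    intro i hi
    have := b.constr_basis (ZMod 2) (fun i => a i • B i + s i • B (i+1)) ⟨i, hi⟩
    rw [hb] at this
    rw [hE]; exact this
  have z2 : ∀ x : ZMod 2, x = 0 ∨ x = 1 := by decide
  have hslast : ∀ i, i + 1 = d → s i = 0 := by
    intro i hi
    have : d - 1 - i = 0 := by omega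
    simp [hs, this]
  have hs1 : ∀ i, i + 1 < d → s i ≠ 0 → s i = 1 ∧ a i = 1 ∧ a (i+1) = 0 ∧ s (i+1) = 0 := by
    intro i hi h0
    have hodd : Odd (d-1-i) := by
      by_contra hc
      simp [hs, hc] at h0
    have hsi : s i = a i := by simp [hs, hodd]
    have hne : ¬ Odd (d-1-(i+1)) := by
      rcases hodd with ⟨k, hk⟩
      rintro ⟨l, hl⟩
      omega
    have := ha (i+1) (by omega) hi
    rw [if_neg hne] at this
    refine ⟨(z2 _).resolve_left h0, ?_, this, ?_⟩
    · rw [← hsi]; exact (z2 _).resolve_left h0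
    · simp [hs, this]
  have hN : ∀ i, i < d → (f - E) (B i) = (1 - s i) • B (i+1) := by
    intro i hi
    rw [LinearMap.sub_apply, hf, hEB i hi, sub_smul, one_smul]; abel
  have hsi : ∀ i, 1 ≤ i → i < d → s i = if Odd (d-1-i) then 1 else 0 := by
    intro i h1 h2
    simp only [hs, ha i h1 h2]; split_ifs <;> rfl
  have hNsq : ∀ i, 1 ≤ i → i + 1 < d → (f - E) ((f - E) (B i)) = 0 := by
    intro i h1 h2
    rw [hN i (by omega), hsi i h1 (by omega)]
    by_cases ho : Odd (d-1-i)
    · simp [ho]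
    · have : Odd (d-1-(i+1)) := by
        rw [Nat.not_odd_iff_even] at ho
        obtain ⟨k, hk⟩ := ho
        exact ⟨k-1, by omega⟩
      rw [map_smul, hN (i+1) h2, hsi (i+1) (by omega) h2]
      simp [this]
  have hN3 : ∀ i, i + 1 < d → (f - E) ((f - E) ((f - E) (B i))) = 0 := by
    intro i hi
    rcases Nat.eq_zero_or_pos i with rfl | hp
    · rcases (show d = 2 ∨ 2 < d by omega) with rfl | hd2
      · rw [hN 0 (by omega)]
        have : s 0 = 1 := by simp [hs, h2 rfl]
        simp [this]
      · rw [hN 0 (by omega), map_smul, map_smul, hNsq 1 le_rfl (by omega), smul_zero]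
    · rw [hNsq i hp hi, map_zero]
  refine ⟨E, f - E, ?_, ?_, by abel⟩
  · refine b.ext fun i => ?_
    obtain ⟨i, hi⟩ := i
    rw [hb, Module.End.mul_apply, hEB i hi, map_add, map_smul, map_smul, hEB i hi]
    by_cases h0 : s i = 0
    · rw [h0]; rcases z2 (a i) with h | h <;> simp [h]
    · have hlt : i + 1 < d := by
        by_contra hc
        exact h0 (hslast i (by omega))
      obtain ⟨q1, q2, q3, q4⟩ := hs1 i hlt h0
      rw [hEB _ hlt, q1, q2, q3, q4]; simp
  · refine b.ext fun i => ?_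
    obtain ⟨i, hi⟩ := i
    have e4 : ∀ x, ((f - E)^4) x = (f-E) ((f-E) ((f-E) ((f-E) x))) := fun x => by
      simp [pow_succ, Module.End.mul_apply]
    rw [hb, e4, LinearMap.zero_apply]
    by_cases hlt : i + 1 < d
    · show (f-E) ((f-E) ((f-E) ((f-E) (B i)))) = 0
      rw [hN3 i hlt, map_zero]
    · show (f-E) ((f-E) ((f-E) ((f-E) (B i)))) = 0
      have hid : i + 1 = d := by omega
      rw [hN i hi, hid, hslast i hid, sub_zero, one_smul]
      have hle : Submodule.span (ZMod 2) (B '' {i | i < d - 1}) ≤ LinearMap.ker ((f-E) * (f-E) * (f-E)) := by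
        rw [Submodule.span_le]
        rintro _ ⟨j, hj, rfl⟩
        have hj' : j < d - 1 := hj
        exact hN3 j (by omega)
      exact hle hB

def QDec (M : Type*) [AddCommGroup M] [Module (ZMod 2)[X] M] : Prop :=
  ∃ E N : M →+ M, (∀ m, E (E m) = E m) ∧ (∀ m, N (N (N (N m))) = 0) ∧
    ∀ m, (X : (ZMod 2)[X]) • m = E m + N m

set_option maxHeartbeats 2000000 in
theorem cyc_main (p : (ZMod 2)[X]) (hp : p.Monic) (hd : 1 ≤ p.natDegree)
    (h2 : p.natDegree = 2 → p.nextCoeff = 1) :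
    QDec ((ZMod 2)[X] ⧸ Submodule.span (ZMod 2)[X] {p}) := by
  classical
  obtain ⟨d, hdd⟩ : ∃ d, d = p.natDegree := ⟨_, rfl⟩
  rw [← hdd] at hd h2
  obtain ⟨a0, ha0⟩ : ∃ a : ℕ → ZMod 2, a = fun i => if Odd (d-1-i) then 1 else 0 := ⟨_, rfl⟩
  obtain ⟨a, ha⟩ : ∃ a : ℕ → ZMod 2, a = fun i => if i = 0 then
      - p.nextCoeff - ∑ j ∈ Finset.range (d-1), a0 (j+1) else a0 i := ⟨_, rfl⟩
  have hsum : ∑ j ∈ Finset.range d, a j = - p.nextCoeff := by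
    obtain ⟨k, rfl⟩ : ∃ k, d = k + 1 := ⟨d-1, by omega⟩
    rw [Finset.sum_range_succ', ha]
    simp
  obtain ⟨q, hq⟩ : ∃ q : ℕ → (ZMod 2)[X], q = fun i => ∏ j ∈ Finset.range i, (X - C (a j)) :=
    ⟨_, rfl⟩
  have hqm : ∀ i, (q i).Monic := fun i => by
    rw [hq]; exact monic_prod_of_monic _ _ fun j _ => monic_X_sub_C _
  have hqdeg : ∀ i, (q i).degree = i := fun i => by
    rw [hq]; simp [degree_prod]
  let S : Polynomial.Sequence (ZMod 2) := ⟨q, hqdeg⟩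
  have hspan : ∀ m, Submodule.span (ZMod 2) (q '' Set.Iio m) = degreeLT (ZMod 2) m := fun m =>
    S.span_degreeLT fun i _ => by
      have : (S i).leadingCoeff = 1 := hqm i
      rw [this]; exact isUnit_one
  have hqs : ∀ i, X * q i = q (i+1) + a i • q i := fun i => by
    have : q (i+1) = q i * (X - C (a i)) := by rw [hq]; exact Finset.prod_range_succ _ _
    rw [this, smul_eq_C_mul]; ring
  let π : (ZMod 2)[X] →ₗ[ZMod 2] ((ZMod 2)[X] ⧸ Submodule.span (ZMod 2)[X] {p}) :=
    (Submodule.mkQ _).restrictScalars (ZMod 2)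
  have hπ : ∀ g, p ∣ g → π g = 0 := fun g hg => by
    show Submodule.Quotient.mk g = 0
    rw [Submodule.Quotient.mk_eq_zero]
    exact Ideal.mem_span_singleton.2 hg
  have hπs : Function.Surjective π := Submodule.mkQ_surjective _
  have hfr : Module.finrank (ZMod 2) ((ZMod 2)[X] ⧸ Submodule.span (ZMod 2)[X] {p}) = d := by
    rw [hdd]; exact finrank_quotient_span_eq_natDegree (f := p)
  have himg : ∀ m, Submodule.span (ZMod 2) ((fun i => π (q i)) '' Set.Iio m)
      = (degreeLT (ZMod 2) m).map π := fun m => by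
    rw [← hspan, Submodule.map_span, Set.image_image]
  have htop : ⊤ ≤ Submodule.span (ZMod 2) (Set.range fun i : Fin d => π (q i)) := by
    rintro x -
    obtain ⟨g, rfl⟩ := hπs x
    have h1 : (Set.range fun i : Fin d => π (q i)) = (fun i => π (q i)) '' Set.Iio d := by
      ext y; constructor
      · rintro ⟨i, rfl⟩; exact ⟨i, i.2, rfl⟩
      · rintro ⟨i, hi, rfl⟩; exact ⟨⟨i, hi⟩, rfl⟩
    rw [h1, himg]
    refine ⟨g %ₘ p, ?_, ?_⟩
    · rw [SetLike.mem_coe, mem_degreeLT, hdd, ← degree_eq_natDegree hp.ne_zero]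
      exact degree_modByMonic_lt _ hp
    · have : g %ₘ p = g - p * (g /ₘ p) := by rw [modByMonic_eq_sub_mul_div]
      rw [this, map_sub, hπ _ (dvd_mul_right _ _), sub_zero]
  let b := basisOfTopLeSpanOfCardEqFinrank (R := ZMod 2) (fun i : Fin d => π (q i)) htop
    (by rw [hfr, Fintype.card_fin])
  let f : ((ZMod 2)[X] ⧸ Submodule.span (ZMod 2)[X] {p}) →ₗ[ZMod 2]
      ((ZMod 2)[X] ⧸ Submodule.span (ZMod 2)[X] {p}) :=
    (LinearMap.lsmul (ZMod 2)[X] _ X).restrictScalars (ZMod 2)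
  have hfx : ∀ g, f (π g) = π (X * g) := fun g => rfl
  obtain ⟨E, N, h1, h3, h4⟩ := abs_lemma d hd f (fun i => π (q i)) b
    (fun i => by simp [b]) a
    (fun i => by
      rw [hfx, hqs, map_add, map_smul])
    (by
      have : {i | i < d - 1} = Set.Iio (d-1) := rfl
      rw [this, himg]
      refine ⟨q d - p, ?_, ?_⟩
      · have hqn : (q d).natDegree = d := natDegree_eq_of_degree_eq_some (hqdeg d)
        rw [SetLike.mem_coe, mem_degreeLT, degree_lt_iff_coeff_zero]
        intro m hm
        rw [coeff_sub, sub_eq_zero]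
        rcases (show m = d - 1 ∨ m = d ∨ d < m by omega) with rfl | rfl | hlt
        · have e1 : (q d).nextCoeff = p.nextCoeff := by
            rw [hq]
            simp only
            rw [Monic.nextCoeff_prod _ _ fun j _ => monic_X_sub_C _]
            simp [hsum]
          rwa [nextCoeff_of_natDegree_pos (by omega), nextCoeff_of_natDegree_pos (by omega),
            hqn, ← hdd] at e1
        · have e1 := hqm m
          rw [Monic, leadingCoeff, hqn] at e1
          have e2 := hp
          rw [Monic, leadingCoeff, ← hdd] at e2
          rw [e1, e2]
        · rw [coeff_eq_zero_of_natDegree_lt (by omega), coeff_eq_zero_of_natDegree_lt (by omega)]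
      · rw [map_sub, hπ p dvd_rfl, sub_zero])
    (fun i hi _ => by
      rw [ha, ha0]; simp [show i ≠ 0 by omega])
    (fun h => by
      have := h2 h
      subst h
      rw [ha, ha0, this]; simp)
  refine ⟨E.toAddMonoidHom, N.toAddMonoidHom, fun m => ?_, fun m => ?_, fun m => ?_⟩
  · exact LinearMap.congr_fun h1 m
  · have := LinearMap.congr_fun h3 m
    simpa [pow_succ, Module.End.mul_apply] using this
  · exact LinearMap.congr_fun h4 m

theorem cyc_all (p : (ZMod 2)[X]) (hp0 : p ≠ 0) :
    QDec ((ZMod 2)[X] ⧸ Submodule.span (ZMod 2)[X] {p}) := by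
  have z2 : ∀ x : ZMod 2, x = 0 ∨ x = 1 := by decide
  have hp : p.Monic := (z2 _).resolve_left (leadingCoeff_ne_zero.2 hp0)
  have kill : ∀ g, p ∣ g → ∀ m : (ZMod 2)[X] ⧸ Submodule.span (ZMod 2)[X] {p}, g • m = 0 := by
    rintro g hg m
    obtain ⟨m, rfl⟩ := Submodule.mkQ_surjective _ m
    rw [← map_smul]
    show Submodule.Quotient.mk _ = 0
    rw [Submodule.Quotient.mk_eq_zero]
    exact Ideal.mem_span_singleton.2 (hg.mul_right _)
  rcases Nat.eq_zero_or_pos p.natDegree with h0 | hpos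
  · have h1 : p = 1 := hp.natDegree_eq_zero.1 h0
    have hz : ∀ m : (ZMod 2)[X] ⧸ Submodule.span (ZMod 2)[X] {p}, m = 0 := fun m => by
      have := kill 1 (by rw [h1]) m
      rwa [one_smul] at this
    exact ⟨0, 0, fun m => rfl, fun m => rfl, fun m => by rw [hz m]; simp⟩
  · by_cases hs : p.natDegree = 2 ∧ p.nextCoeff = 0
    · obtain ⟨hd, hn⟩ := hs
      rw [nextCoeff_of_natDegree_pos (by omega), hd] at hn
      have hl : p.coeff 2 = 1 := by
        have := hp.coeff_natDegree
        rwa [hd] at this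
      have hpe : p = X ^ 2 - C (p.coeff 0) ^ 2 := by
        have := p.as_sum_range_C_mul_X_pow
        rw [hd] at this
        simp only [Finset.sum_range_succ, Finset.sum_range_zero, hl] at this
        norm_num at hn
        rw [hn] at this
        have hc : C (p.coeff 0) = - C (p.coeff 0) ^ 2 := by
          rcases z2 (p.coeff 0) with h | h <;> rw [h]
          · simp
          · rw [← C_pow, ← C_neg]; rfl
        rw [sub_eq_add_neg, ← hc]
        conv_lhs => rw [this]
        simp [add_comm]
      have two0 : (2 : (ZMod 2)[X]) = 0 := by
        rw [show (2 : (ZMod 2)[X]) = C 2 from (map_ofNat C 2).symm]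
        rw [show (2 : ZMod 2) = 0 by decide, C_0]
      obtain ⟨c, hc⟩ : ∃ c, c = C (p.coeff 0) := ⟨_, rfl⟩
      rw [← hc] at hpe
      have hcc : c * c = c := by
        rw [hc, ← C_mul]; congr 1; rcases z2 (p.coeff 0) with h | h <;> rw [h] <;> rfl
      refine ⟨DistribSMul.toAddMonoidHom _ c, DistribSMul.toAddMonoidHom _ (X - c), fun m => ?_,
        fun m => ?_, fun m => ?_⟩
      · show c • c • m = c • m
        rw [smul_smul, hcc]
      · show (X - c) • (X - c) • (X - c) • (X - c) • m = 0
        rw [smul_smul, smul_smul, smul_smul]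
        refine kill _ ?_ m
        have : (X - c) * (X - c) = p := by
          rw [hpe]
          linear_combination (c^2 - X * c) * two0
        rw [mul_assoc, this]; exact dvd_mul_left _ _
      · show X • m = c • m + (X - c) • m
        rw [← add_smul]; congr 1; ring
    · refine cyc_main p hp hpos fun h => ?_
      exact (z2 _).resolve_left fun h' => hs ⟨h, h'⟩

theorem QDec.of_equiv {M M' : Type*} [AddCommGroup M] [Module (ZMod 2)[X] M]
    [AddCommGroup M'] [Module (ZMod 2)[X] M'] (φ : M ≃ₗ[(ZMod 2)[X]] M') (h : QDec M') :
    QDec M := by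
  obtain ⟨E, N, h1, h2, h3⟩ := h
  refine ⟨(φ.symm.toLinearMap.toAddMonoidHom.comp E).comp φ.toLinearMap.toAddMonoidHom,
    (φ.symm.toLinearMap.toAddMonoidHom.comp N).comp φ.toLinearMap.toAddMonoidHom, ?_, ?_, ?_⟩
  · intro m; simp [h1]
  · intro m; simp [h2]
  · intro m
    apply φ.injective
    simp [h3]

theorem QDec.directSum {ι : Type*} (M : ι → Type*) [∀ i, AddCommGroup (M i)]
    [∀ i, Module (ZMod 2)[X] (M i)] (h : ∀ i, QDec (M i)) : QDec (DirectSum ι M) := by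
  choose E N h1 h2 h3 using h
  refine ⟨DirectSum.map E, DirectSum.map N, fun m => ?_, fun m => ?_, fun m => ?_⟩
  · refine DFinsupp.ext fun i => ?_
    simp [h1]
  · refine DFinsupp.ext fun i => ?_
    simp [h2]
  · refine DFinsupp.ext fun i => ?_
    rw [DirectSum.smul_apply, DirectSum.add_apply]
    simp [h3]

theorem end_dec {V : Type*} [AddCommGroup V] [Module (ZMod 2) V] [FiniteDimensional (ZMod 2) V]
    (f : V →ₗ[ZMod 2] V) :
    ∃ E N : V →ₗ[ZMod 2] V, E * E = E ∧ N ^ 4 = 0 ∧ f = E + N := by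
  obtain ⟨ι, _, p, hp, e, ⟨φ⟩⟩ := Module.equiv_directSum_of_isTorsion
    (Module.AEval.isTorsion_of_finiteDimensional (ZMod 2) V f)
  obtain ⟨E, N, h1, h2, h3⟩ := QDec.of_equiv φ
    (QDec.directSum _ fun i => cyc_all (p i ^ e i) (pow_ne_zero _ (hp i).ne_zero))
  refine ⟨AddMonoidHom.toZModLinearMap 2 (M := V) (M₁ := V) E,
    AddMonoidHom.toZModLinearMap 2 (M := V) (M₁ := V) N, ?_, ?_, ?_⟩
  · ext m; exact h1 m
  · ext m; exact h2 m
  · ext m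
    have := h3 (Module.AEval'.of f m)
    rw [Module.AEval'.X_smul_of] at this
    exact this

theorem Mn_F2_almost_n_torsion_clean_of_four_le_k1 (n : ℕ) (hn : 2 < n)
    (h : 4 ≤ k1 n) :
    AlmostTorsionClean (Matrix (Fin n) (Fin n) (ZMod 2)) n := by
  intro r
  obtain ⟨k, hk⟩ := four_dvd n hn h
  obtain ⟨E, N, h1, h2, h3⟩ := end_dec (Matrix.toLinAlgEquiv' (r - 1))
  obtain ⟨E, rfl⟩ := (Matrix.toLinAlgEquiv' (R := ZMod 2) (n := Fin n)).surjective E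
  obtain ⟨N, rfl⟩ := (Matrix.toLinAlgEquiv' (R := ZMod 2) (n := Fin n)).surjective N
  rw [← map_mul, EmbeddingLike.apply_eq_iff_eq] at h1
  rw [← map_pow, EmbeddingLike.map_eq_zero_iff] at h2
  rw [← map_add, EmbeddingLike.apply_eq_iff_eq] at h3
  have h4 : (1 + N) ^ 4 = 1 := by
    have two0 : ∀ A : Matrix (Fin n) (Fin n) (ZMod 2), 2 • A = 0 := fun A => by
      ext i j; simp only [Matrix.smul_apply, Matrix.zero_apply]
      generalize A i j = x; revert x; decide
    have : (1 + N) ^ 4 = 1 + 2 • (2 • N + 3 • N^2 + 2 • N^3) + N ^ 4 := by noncomm_ring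
    rw [this, two0, h2]; simp
  have h5 : (1 + N) ^ n = 1 := by
    have : ∀ j, j = 4 * k → (1 + N) ^ j = 1 := fun j hj => by rw [hj, pow_mul, h4, one_pow]
    exact this n hk
  refine ⟨1 + N, E, IsUnit.of_pow_eq_one h5 (by omega), h5, h1, ?_⟩
  rw [sub_eq_iff_eq_add] at h3
  rw [h3]; abel
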